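/- For all n ≥ 0 and all m, k ≥ M: β^{n,m,k}(1^{⊗n}) = 1^{⊗(m+n+k)}, and β^{n,m,k} is multiplicative: β^{n,m,k}(X) · β^{n,m,k}(Y) = β^{n,m,k}(X·Y) for all X, Y ∈ (M_d(ℂ))^{⊗n}. (Hence the conjugation by the matrix product unitary, restricted with fusion-tensor boundaries, is a unital algebra homomorphism on local observables.) -/

import Mathlib

open Matrix
open scoped Kronecker

/-- The stacked two-layer MPO chain
`T^{(N)}_{i,k} := Σ_j (u_{i₁j₁}·⋯·u_{i_Nj_N}) ⊗ (ū_{j₁k₁}·⋯·ū_{j_Nk_N})`. -/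
noncomputable def chainT {d D D' : ℕ}
    (u : Fin d → Fin d → Matrix (Fin D) (Fin D) ℂ)
    (ub : Fin d → Fin d → Matrix (Fin D') (Fin D') ℂ)
    {N : ℕ} (i k : Fin N → Fin d) :
    Matrix (Fin D × Fin D') (Fin D × Fin D') ℂ :=
  ∑ j : Fin N → Fin d,
    ((List.ofFn fun t => u (i t) (j t)).prod) ⊗ₖ ((List.ofFn fun t => ub (j t) (k t)).prod)

/-- The conjugation `B^{(N)}(Y)` of an `N`-site operator `Y` by the MPU, with
boundaries closed by the fusion data `(w, φ)`:
`B(Y)_{I,K} := Σ_{J,J′} Y_{J,J′} · φ((u_{I₁J₁}⋯ ⊗ ū_{J′₁K₁}⋯)·w)`. -/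
noncomputable def Bmap {d D D' : ℕ}
    (u : Fin d → Fin d → Matrix (Fin D) (Fin D) ℂ)
    (ub : Fin d → Fin d → Matrix (Fin D') (Fin D') ℂ)
    (φ w : Fin D × Fin D' → ℂ)
    {N : ℕ} (Y : Matrix (Fin N → Fin d) (Fin N → Fin d) ℂ) :
    Matrix (Fin N → Fin d) (Fin N → Fin d) ℂ :=
  Matrix.of fun I K => ∑ J : Fin N → Fin d, ∑ J' : Fin N → Fin d,
    Y J J' * ∑ p, φ p *
      ((((List.ofFn fun t => u (I t) (J t)).prod) ⊗ₖ
        ((List.ofFn fun t => ub (J' t) (K t)).prod)).mulVec w p)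

/-- Left third of a tuple of length `m + n + k`. -/
def leftPart {d : ℕ} (m n k : ℕ) (I : Fin (m + n + k) → Fin d) : Fin m → Fin d :=
  fun t => I (Fin.castAdd k (Fin.castAdd n t))

/-- Middle third of a tuple of length `m + n + k`. -/
def midPart {d : ℕ} (m n k : ℕ) (I : Fin (m + n + k) → Fin d) : Fin n → Fin d :=
  fun t => I (Fin.castAdd k (Fin.natAdd m t))

/-- Right third of a tuple of length `m + n + k`. -/
def rightPart {d : ℕ} (m n k : ℕ) (I : Fin (m + n + k) → Fin d) : Fin k → Fin d :=
  fun t => I (Fin.natAdd (m + n) t)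

/-- `β^{n,m,k}(X) := B^{(m+n+k)}(1^{⊗m} ⊗ X ⊗ 1^{⊗k})`. -/
noncomputable def betaMap {d D D' : ℕ}
    (u : Fin d → Fin d → Matrix (Fin D) (Fin D) ℂ)
    (ub : Fin d → Fin d → Matrix (Fin D') (Fin D') ℂ)
    (φ w : Fin D × Fin D' → ℂ)
    (n m k : ℕ) (X : Matrix (Fin n → Fin d) (Fin n → Fin d) ℂ) :
    Matrix (Fin (m + n + k) → Fin d) (Fin (m + n + k) → Fin d) ℂ :=
  Bmap u ub φ w (Matrix.of fun I K =>
    (if leftPart m n k I = leftPart m n k K then 1 else 0) *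
    (if rightPart m n k I = rightPart m n k K then 1 else 0) *
    X (midPart m n k I) (midPart m n k K))

/-- The matrix product `A (I₁) (J₁) ⋯ A (I_N) (J_N)` along a pair of multi-indices. -/
noncomputable def mpoProd {d D : ℕ} (A : Fin d → Fin d → Matrix (Fin D) (Fin D) ℂ)
    {N : ℕ} (I J : Fin N → Fin d) : Matrix (Fin D) (Fin D) ℂ :=
  (List.ofFn fun t => A (I t) (J t)).prod

/-- The operator on `N` sites obtained by closing the chain of tensors periodically. -/
noncomputable def periodicMPO {d D : ℕ} (A : Fin d → Fin d → Matrix (Fin D) (Fin D) ℂ)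
    (N : ℕ) : Matrix (Fin N → Fin d) (Fin N → Fin d) ℂ :=
  Matrix.of fun I J => (mpoProd A I J).trace

/-- The operator-valued insertion `∑ X_{J,J′} (u_{I₁J₁}⋯) ⊗ (ū_{J′₁K₁}⋯)` on the bond space. -/
noncomputable def insertion {d D D' : ℕ}
    (u : Fin d → Fin d → Matrix (Fin D) (Fin D) ℂ)
    (ub : Fin d → Fin d → Matrix (Fin D') (Fin D') ℂ)
    {N : ℕ} (X : Matrix (Fin N → Fin d) (Fin N → Fin d) ℂ) (I K : Fin N → Fin d) :
    Matrix (Fin D × Fin D') (Fin D × Fin D') ℂ :=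
  ∑ J, ∑ J', X J J' • (mpoProd u I J ⊗ₖ mpoProd ub J' K)

/-- `1^{⊗m} ⊗ X ⊗ 1^{⊗k}`. -/
noncomputable def padOne {d : ℕ} (m n k : ℕ)
    (X : Matrix (Fin n → Fin d) (Fin n → Fin d) ℂ) :
    Matrix (Fin (m + n + k) → Fin d) (Fin (m + n + k) → Fin d) ℂ :=
  Matrix.of fun I K =>
    (if leftPart m n k I = leftPart m n k K then 1 else 0) *
    (if rightPart m n k I = rightPart m n k K then 1 else 0) *
    X (midPart m n k I) (midPart m n k K)

lemma mpoProd_append {d D : ℕ} (A : Fin d → Fin d → Matrix (Fin D) (Fin D) ℂ)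
    {m n : ℕ} (i k : Fin m → Fin d) (j l : Fin n → Fin d) :
    mpoProd A (Fin.append i j) (Fin.append k l) = mpoProd A i k * mpoProd A j l := by
  have h : (fun t => A (Fin.append i j t) (Fin.append k l t))
      = Fin.append (fun t => A (i t) (k t)) (fun t => A (j t) (l t)) := by
    funext t
    refine Fin.addCases (fun s => ?_) (fun s => ?_) t <;> simp
  rw [mpoProd, h, List.ofFn_fin_append, List.prod_append]
  rfl

lemma sum_fin_add_pi {d : ℕ} {α : Type*} [AddCommMonoid α] {m n : ℕ}
    (f : (Fin (m + n) → Fin d) → α) :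
    ∑ J, f J = ∑ a : Fin m → Fin d, ∑ b : Fin n → Fin d, f (Fin.append a b) := by
  rw [← (Fin.appendEquiv m n).sum_comp, Fintype.sum_prod_type]
  rfl

lemma append_parts {d m n k : ℕ} (I : Fin (m + n + k) → Fin d) :
    Fin.append (Fin.append (leftPart m n k I) (midPart m n k I)) (rightPart m n k I) = I := by
  funext t
  refine Fin.addCases (fun s => ?_) (fun s => ?_) t
  · refine Fin.addCases (fun r => ?_) (fun r => ?_) s <;> simp [leftPart, midPart]
  · simp [rightPart]

lemma leftPart_append {d m n k : ℕ} (a : Fin m → Fin d) (b : Fin n → Fin d) (c : Fin k → Fin d) :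
    leftPart m n k (Fin.append (Fin.append a b) c) = a := by
  funext t; simp [leftPart]

lemma midPart_append {d m n k : ℕ} (a : Fin m → Fin d) (b : Fin n → Fin d) (c : Fin k → Fin d) :
    midPart m n k (Fin.append (Fin.append a b) c) = b := by
  funext t; simp [midPart]

lemma rightPart_append {d m n k : ℕ} (a : Fin m → Fin d) (b : Fin n → Fin d)
    (c : Fin k → Fin d) :
    rightPart m n k (Fin.append (Fin.append a b) c) = c := by
  funext t; simp [rightPart]

lemma padOne_mul {d m n k : ℕ} (X Y : Matrix (Fin n → Fin d) (Fin n → Fin d) ℂ) :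
    padOne m n k X * padOne m n k Y = padOne m n k (X * Y) := by
  ext I K
  simp only [padOne, mul_apply, of_apply, sum_fin_add_pi, leftPart_append, midPart_append,
    rightPart_append]
  rw [Finset.sum_eq_single (leftPart m n k I) (by intro a _ ha; simp [ha.symm]) (by simp),
    Finset.mul_sum]
  refine Finset.sum_congr rfl fun b _ => ?_
  rw [Finset.sum_eq_single (rightPart m n k I) (by intro a _ ha; simp [ha.symm]) (by simp)]
  simp only [if_true]
  ring

lemma padOne_one {d m n k : ℕ} :
    padOne m n k (1 : Matrix (Fin n → Fin d) (Fin n → Fin d) ℂ) = 1 := by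
  ext I K
  have h : I = K ↔ leftPart m n k I = leftPart m n k K ∧ midPart m n k I = midPart m n k K ∧
      rightPart m n k I = rightPart m n k K := by
    refine ⟨fun h => by simp [h], fun ⟨h₁, h₂, h₃⟩ => ?_⟩
    rw [← append_parts I, ← append_parts K, h₁, h₂, h₃]
  simp only [padOne, of_apply, one_apply, h]
  split_ifs <;> simp_all

section Stacked

variable {d D D' : ℕ} (u : Fin d → Fin d → Matrix (Fin D) (Fin D) ℂ)
  (ub : Fin d → Fin d → Matrix (Fin D') (Fin D') ℂ)

lemma chainT_eq_sum {N : ℕ} (i k : Fin N → Fin d) :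
    chainT u ub i k = ∑ j, mpoProd u i j ⊗ₖ mpoProd ub j k := rfl

lemma chainT_append {m n : ℕ} (i k : Fin m → Fin d) (j l : Fin n → Fin d) :
    chainT u ub (Fin.append i j) (Fin.append k l) = chainT u ub i k * chainT u ub j l := by
  simp only [chainT_eq_sum, sum_fin_add_pi, mpoProd_append, mul_kronecker_mul,
    Finset.sum_mul_sum]

lemma chainT_zero (i k : Fin 0 → Fin d) : chainT u ub i k = 1 := by
  simp [chainT]

lemma insertion_one {N : ℕ} (I K : Fin N → Fin d) :
    insertion u ub 1 I K = chainT u ub I K := by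
  simp [insertion, chainT_eq_sum, one_apply, ite_smul]

lemma insertion_padOne {m n k : ℕ} (X : Matrix (Fin n → Fin d) (Fin n → Fin d) ℂ)
    (a a' : Fin m → Fin d) (b b' : Fin n → Fin d) (c c' : Fin k → Fin d) :
    insertion u ub (padOne m n k X) (Fin.append (Fin.append a b) c)
        (Fin.append (Fin.append a' b') c')
      = chainT u ub a a' * insertion u ub X b b' * chainT u ub c c' := by
  simp only [insertion, chainT_eq_sum, sum_fin_add_pi, padOne, of_apply, leftPart_append,
    midPart_append, rightPart_append, mpoProd_append, mul_kronecker_mul, Finset.sum_mul,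
    Finset.mul_sum, ite_mul, mul_ite, one_mul, zero_mul, mul_zero, ite_smul, zero_smul, mul_one,
    Finset.sum_ite_eq, Finset.sum_ite_irrel, Finset.sum_const_zero, Finset.mem_univ, if_true,
    smul_mul_assoc, mul_smul_comm, Finset.smul_sum]
  conv_rhs => enter [2, x, 2, y]; rw [Finset.sum_comm]
  conv_rhs => enter [2, x]; rw [Finset.sum_comm]
  conv_rhs => rw [Finset.sum_comm]
  conv_rhs => enter [2, x]; rw [Finset.sum_comm]

lemma Bmap_apply (φ w : Fin D × Fin D' → ℂ) {N : ℕ}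
    (Y : Matrix (Fin N → Fin d) (Fin N → Fin d) ℂ) (I K : Fin N → Fin d) :
    Bmap u ub φ w Y I K = φ ⬝ᵥ insertion u ub Y I K *ᵥ w := by
  simp only [insertion, sum_mulVec, dotProduct_sum, smul_mulVec, dotProduct_smul, smul_eq_mul]
  rfl

lemma periodicMPO_conj_apply {N : ℕ}
    (Y : Matrix (Fin N → Fin d) (Fin N → Fin d) ℂ) (I K : Fin N → Fin d) :
    (periodicMPO u N * Y * periodicMPO ub N) I K = (insertion u ub Y I K).trace := by
  simp only [insertion, trace_sum, trace_smul, trace_kronecker, mul_apply, periodicMPO, of_apply,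
    Finset.sum_mul, smul_eq_mul]
  rw [Finset.sum_comm]
  refine Finset.sum_congr rfl fun J _ => Finset.sum_congr rfl fun J' _ => ?_
  ring

/-- If long chains factorize through the fusion data, then the conjugation with fusion-tensor
boundaries is the conjugation by the periodically closed operators. -/
lemma betaMap_eq_periodicMPO_conj (φ w : Fin D × Fin D' → ℂ) {n m k : ℕ}
    (h : ∀ (c c' : Fin k → Fin d) (a a' : Fin m → Fin d),
      chainT u ub c c' * chainT u ub a a'
        = vecMulVec (chainT u ub c c' *ᵥ w) (φ ᵥ* chainT u ub a a'))
    (X : Matrix (Fin n → Fin d) (Fin n → Fin d) ℂ) :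
    betaMap u ub φ w n m k X
      = periodicMPO u (m + n + k) * padOne m n k X * periodicMPO ub (m + n + k) := by
  ext I K
  rw [periodicMPO_conj_apply]
  change Bmap u ub φ w (padOne m n k X) I K = _
  rw [Bmap_apply, ← append_parts I, ← append_parts K, insertion_padOne, trace_mul_comm,
    ← Matrix.mul_assoc, h, trace_mul_comm, mul_vecMulVec, trace_vecMulVec, ← mulVec_mulVec,
    ← mulVec_mulVec, dotProduct_mulVec, dotProduct_comm]

end Stacked


/-- For all `n ≥ 0` and `m, k ≥ M`: `β^{n,m,k}(1^{⊗n}) = 1^{⊗(m+n+k)}`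
and `β^{n,m,k}` is multiplicative; hence the conjugation by the matrix product unitary,
restricted with fusion-tensor boundaries, is a unital algebra homomorphism on local
observables. -/
theorem stmt_15 {d D D' : ℕ} (hd : 1 ≤ d) (hD : 1 ≤ D) (hD' : 1 ≤ D')
    (u : Fin d → Fin d → Matrix (Fin D) (Fin D) ℂ)
    (ub : Fin d → Fin d → Matrix (Fin D') (Fin D') ℂ)
    (φ w : Fin D × Fin D' → ℂ)
    (hφw : (∑ p, φ p * w p) = 1)
    (hCap : ∀ (N : ℕ) (i k : Fin N → Fin d),
      (∑ p, φ p * (chainT u ub i k).mulVec w p) = if i = k then 1 else 0)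
    (M : ℕ)
    (hFact : ∀ (m k n : ℕ), M ≤ m → M ≤ k →
      ∀ (i i' : Fin m → Fin d) (j j' : Fin n → Fin d) (l l' : Fin k → Fin d),
        chainT u ub (Fin.append (Fin.append i j) l) (Fin.append (Fin.append i' j') l')
          = (if j = j' then (1 : ℂ) else 0) •
              Matrix.of fun p q =>
                (chainT u ub i i').mulVec w p * Matrix.vecMul φ (chainT u ub l l') q) :
    ∀ (n m k : ℕ), M ≤ m → M ≤ k →
      betaMap u ub φ w n m k (1 : Matrix (Fin n → Fin d) (Fin n → Fin d) ℂ) = 1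
      ∧ ∀ X Y : Matrix (Fin n → Fin d) (Fin n → Fin d) ℂ,
          betaMap u ub φ w n m k X * betaMap u ub φ w n m k Y
            = betaMap u ub φ w n m k (X * Y) := by
  intro n m k hm hk
  have hconj := betaMap_eq_periodicMPO_conj u ub φ w (n := n) (m := m) (k := k)
    fun c c' a a' => by
      have h := hFact k m 0 hk hm c c' Fin.elim0 Fin.elim0 a a'
      rw [chainT_append, chainT_append, chainT_zero, mul_one, if_pos rfl, one_smul] at h
      exact h
  have hone : betaMap u ub φ w n m k 1 = 1 := by
    change Bmap u ub φ w (padOne m n k 1) = 1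
    ext I K
    rw [padOne_one, Bmap_apply, insertion_one, one_apply]
    exact hCap _ I K
  have hinv : periodicMPO ub (m + n + k) * periodicMPO u (m + n + k) = 1 := by
    rw [hconj, padOne_one, mul_one] at hone
    exact mul_eq_one_comm.mp hone
  refine ⟨hone, fun X Y => ?_⟩
  rw [hconj, hconj, hconj, ← padOne_mul]
  simp only [← Matrix.mul_assoc]
  rw [Matrix.mul_assoc _ (periodicMPO ub (m + n + k)), hinv, Matrix.mul_one]
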